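/- There exists C > 0 such that for every u ∈ X^{0,1/2,1} and every dyadic number L ≥ 1, ‖χ(Lt)u‖_{L²(R×T)} ≤ C L^{−1/2} ‖u‖_{X^{0,1/2,1}}. -/

import Mathlib

open MeasureTheory Complex Real Set Filter
open scoped ENNReal NNReal

noncomputable section

/-- **Hypothesis 1**: `p` is the symbol of the dispersive operator `L_{α+1}`
(the Fourier multiplier by `-i p(ξ)`); `p` is an odd real-valued function of class `C¹`
on `ℝ` and `C²` away from the origin, and for `ξ ≥ ξ₀` the first and second derivatives
of `p` are comparable to `ξ^α` and `ξ^(α-1)` respectively. -/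
structure Hyp1 (α ξ₀ c C : ℝ) (p : ℝ → ℝ) : Prop where
  xi0_pos : 0 < ξ₀
  c_pos : 0 < c
  c_le_C : c ≤ C
  smooth1 : ContDiff ℝ 1 p
  smooth2 : ∀ x : ℝ, x ≠ 0 → ContDiffAt ℝ 2 p x
  odd : ∀ x : ℝ, p (-x) = -p x
  deriv_lb : ∀ ξ : ℝ, ξ₀ ≤ ξ → c * ξ ^ α ≤ deriv p ξ
  deriv_ub : ∀ ξ : ℝ, ξ₀ ≤ ξ → deriv p ξ ≤ C * ξ ^ α
  deriv2_lb : ∀ ξ : ℝ, ξ₀ ≤ ξ → c * ξ ^ (α - 1) ≤ deriv (deriv p) ξ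
  deriv2_ub : ∀ ξ : ℝ, ξ₀ ≤ ξ → deriv (deriv p) ξ ≤ C * ξ ^ (α - 1)

/-- The fixed smooth even cutoff function `χ`: `0 ≤ χ ≤ 1`, `χ ≡ 1` on `[-1,1]`,
`supp χ ⊆ [-2,2]`. -/
structure CutoffFun (χ : ℝ → ℝ) : Prop where
  smooth : ContDiff ℝ (⊤ : ℕ∞) χ
  even : ∀ x : ℝ, χ (-x) = χ x
  nonneg : ∀ x : ℝ, 0 ≤ χ x
  le_one : ∀ x : ℝ, χ x ≤ 1
  eq_one : ∀ x ∈ Set.Icc (-1 : ℝ) 1, χ x = 1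
  compact_supp : ∀ x : ℝ, χ x ≠ 0 → x ∈ Set.Icc (-2 : ℝ) 2

/-- The Littlewood–Paley symbol `φ_N`: for a dyadic `N ≥ 1`, `φ_N(ξ) = χ(ξ/N) - χ(2ξ/N)`,
and `φ_0(ξ) = χ(2ξ)`. -/
def lpSymb (χ : ℝ → ℝ) (N ξ : ℝ) : ℝ :=
  if N = 0 then χ (2 * ξ) else χ (ξ / N) - χ (2 * ξ / N)

/-- The Littlewood–Paley projector `P_N`, acting on the (spatial) Fourier coefficients
of a function on the torus. -/
def PN (χ : ℝ → ℝ) (N : ℝ) (u : ℤ → ℂ) : ℤ → ℂ := fun ξ => (lpSymb χ N ξ : ℂ) * u ξ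

/-- Square of the `L²(𝕋)` norm, computed on Fourier coefficients (Parseval). -/
def l2sq (v : ℤ → ℂ) : ℝ := ∑' ξ : ℤ, ‖v ξ‖ ^ 2

/-- `L²(S × 𝕋)` norm of a space-time function given by its spatial Fourier
coefficients `U t ξ`, `S ⊆ ℝ` a set of times. -/
def L2normOn (S : Set ℝ) (U : ℝ → ℤ → ℂ) : ℝ := (∫ t in S, l2sq (U t)) ^ ((1:ℝ)/2)

/-- `L²(ℝ × 𝕋)` norm. -/
def L2full (U : ℝ → ℤ → ℂ) : ℝ := (∫ t : ℝ, l2sq (U t)) ^ ((1:ℝ)/2)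

/-- `L^∞(]0,T[; L²(𝕋))` norm. -/
def LinfL2 (T : ℝ) (U : ℝ → ℤ → ℂ) : ℝ := ⨆ t : Set.Ioo (0:ℝ) T, (l2sq (U t)) ^ ((1:ℝ)/2)

/-- Membership in `L²(ℝ × 𝕋)`. -/
def MemL2 (U : ℝ → ℤ → ℂ) : Prop :=
  (∀ t : ℝ, Summable fun ξ : ℤ => ‖U t ξ‖ ^ 2) ∧
  (∀ ξ : ℤ, Measurable fun t : ℝ => U t ξ) ∧
  Integrable (fun t : ℝ => l2sq (U t))

/-- Membership in `L^∞(]0,T[; L²(𝕋))`, together with measurability of the coefficients. -/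
def MemLinfL2 (T : ℝ) (U : ℝ → ℤ → ℂ) : Prop :=
  (∀ t ∈ Set.Ioo (0:ℝ) T, Summable fun ξ : ℤ => ‖U t ξ‖ ^ 2) ∧
  (∀ ξ : ℤ, Measurable fun t : ℝ => U t ξ) ∧
  (∃ M : ℝ, ∀ t ∈ Set.Ioo (0:ℝ) T, l2sq (U t) ≤ M)

/-- Continuity with values in `L²(𝕋)` on `[0,T]`. -/
def ContL2On (T : ℝ) (U : ℝ → ℤ → ℂ) : Prop :=
  ∀ t₀ ∈ Set.Icc (0:ℝ) T,
    Filter.Tendsto (fun t => l2sq (fun ξ => U t ξ - U t₀ ξ))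
      (nhdsWithin t₀ (Set.Icc (0:ℝ) T)) (nhds 0)

/-- Time Fourier transform (with the convention `∫ e^{-iτt} g(t) dt`). -/
def FT (g : ℝ → ℂ) (τ : ℝ) : ℂ := ∫ t : ℝ, Complex.exp (-(Complex.I * τ * t)) * g t

/-- Inverse time Fourier transform. -/
def IFT (g : ℝ → ℂ) (t : ℝ) : ℂ :=
  (2 * Real.pi)⁻¹ • ∫ τ : ℝ, Complex.exp (Complex.I * τ * t) * g τ

/-- The modulation projector `Q_L`, a space-time Fourier multiplier with symbol
`ψ_L(τ,ξ) = φ_L(τ - p(ξ))` (acting on spatial Fourier coefficients `U t ξ`). -/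
def QL (χ p : ℝ → ℝ) (L : ℝ) (U : ℝ → ℤ → ℂ) : ℝ → ℤ → ℂ := fun t ξ =>
  IFT (fun τ => (lpSymb χ L (τ - p ξ) : ℂ) * FT (fun s => U s ξ) τ) t

/-- `Q_{≤ 2^l} = Q_0 + ∑_{j ≤ l} Q_{2^j}`. -/
def Qle (χ p : ℝ → ℝ) (l : ℕ) (U : ℝ → ℤ → ℂ) : ℝ → ℤ → ℂ := fun t ξ =>
  QL χ p 0 U t ξ + ∑ j ∈ Finset.range (l + 1), QL χ p ((2:ℝ) ^ j) U t ξ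

/-- The `X^{0,1/2,1}` (Besov–Bourgain) norm:
`‖u‖ = ∑_L max(L,1)^{1/2} ‖Q_L u‖_{L²(ℝ×𝕋)}`, `L` running over `{0} ∪ 2^ℕ`. -/
def Xhalf (χ p : ℝ → ℝ) (U : ℝ → ℤ → ℂ) : ℝ :=
  L2full (QL χ p 0 U) + ∑' l : ℕ, ((2:ℝ) ^ l) ^ ((1:ℝ)/2) * L2full (QL χ p ((2:ℝ) ^ l) U)

/-- Membership in `X^{0,1/2,1}` (with the regularity needed for all the
norms entering the statements to be given by genuinely convergent sums and
integrals). -/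
def MemX (χ p : ℝ → ℝ) (U : ℝ → ℤ → ℂ) : Prop :=
  (∀ ξ : ℤ, Measurable fun t : ℝ => U t ξ) ∧
  (∀ ξ : ℤ, Integrable fun t : ℝ => U t ξ) ∧
  (∀ t : ℝ, Summable fun ξ : ℤ => ‖QL χ p 0 U t ξ‖ ^ 2) ∧
  (∀ l : ℕ, ∀ t : ℝ, Summable fun ξ : ℤ => ‖QL χ p ((2:ℝ) ^ l) U t ξ‖ ^ 2) ∧
  Integrable (fun t : ℝ => l2sq (QL χ p 0 U t)) ∧
  (∀ l : ℕ, Integrable fun t : ℝ => l2sq (QL χ p ((2:ℝ) ^ l) U t)) ∧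
  Summable (fun l : ℕ => ((2:ℝ) ^ l) ^ ((1:ℝ)/2) * L2full (QL χ p ((2:ℝ) ^ l) U))

/-- The bilinear operator `Λ_a`:
`(Λ_a(u,v))^(ξ) = ∑_{ξ₁+ξ₂=ξ} a(ξ₁,ξ₂) û(ξ₁) v̂(ξ₂)`. -/
def Lam (a : ℝ → ℝ → ℂ) (u v : ℤ → ℂ) : ℤ → ℂ := fun ξ =>
  ∑' ξ₁ : ℤ, a ξ₁ ((ξ : ℝ) - ξ₁) * u ξ₁ * v (ξ - ξ₁)

/-- `u` solves `∂_t u + L_{α+1} u + ∂_x f = 0` on `]0,T[ × 𝕋` (in the distributional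
sense), formulated equivalently through the Duhamel formula on each spatial Fourier
mode; `U` and `F` are the spatial Fourier coefficients of `u` and `f`. -/
def Solves (p : ℝ → ℝ) (T : ℝ) (U F : ℝ → ℤ → ℂ) : Prop :=
  ∀ ξ : ℤ, ∀ t ∈ Set.Icc (0:ℝ) T,
    U t ξ = Complex.exp (Complex.I * (p ξ) * t) * U 0 ξ -
      ∫ s in (0:ℝ)..t,
        Complex.exp (Complex.I * (p ξ) * (t - s)) * (Complex.I * (ξ:ℂ)) * F s ξ

/-- Fourier coefficients of the free evolution `e^{-tL_{α+1}} φ`. -/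
def freeEvol (p : ℝ → ℝ) (φ : ℤ → ℂ) : ℝ → ℤ → ℂ := fun t ξ =>
  Complex.exp (Complex.I * (p ξ) * t) * φ ξ


open FourierTransform SchwartzMap in
theorem aux_fourierInv_adj {G : ℝ → ℂ} (hG : Integrable G) (φ : 𝓢(ℝ, ℂ)) :
    ∫ t, φ t • (𝓕⁻ G) t = ∫ w, (𝓕⁻ φ) w • G w := by
  have h1 := VectorFourier.integral_fourierIntegral_smul_eq_flip (L := -innerₗ ℝ)
    (e := Real.fourierChar) (μ := volume) (ν := volume) (f := (φ : ℝ → ℂ)) (g := G)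
    Real.continuous_fourierChar (by simp; fun_prop) φ.integrable hG
  have h2 : (-innerₗ ℝ : ℝ →ₗ[ℝ] ℝ →ₗ[ℝ] ℝ).flip = -innerₗ ℝ := by
    ext; simp
  rw [h2] at h1
  rw [SchwartzMap.fourierInv_coe]
  exact h1.symm

open FourierTransform SchwartzMap in
theorem aux_fourier_adj {G : ℝ → ℂ} (hG : Integrable G) (φ : 𝓢(ℝ, ℂ)) :
    ∫ t, φ t • (𝓕 G) t = ∫ w, (𝓕 φ) w • G w := by
  have h1 := VectorFourier.integral_fourierIntegral_smul_eq_flip (L := innerₗ ℝ)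
    (e := Real.fourierChar) (μ := volume) (ν := volume) (f := (φ : ℝ → ℂ)) (g := G)
    Real.continuous_fourierChar (by simp; fun_prop) φ.integrable hG
  have h2 : (innerₗ ℝ : ℝ →ₗ[ℝ] ℝ →ₗ[ℝ] ℝ).flip = innerₗ ℝ := by
    ext; simp
  rw [h2] at h1
  rw [SchwartzMap.fourier_coe]
  exact h1.symm

open FourierTransform in
theorem aux_cont {G : ℝ → ℂ} (hG : Integrable G) : Continuous (𝓕 G) :=
  VectorFourier.fourierIntegral_continuous Real.continuous_fourierChar (by simp; fun_prop) hG

open FourierTransform in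
theorem aux_contInv {G : ℝ → ℂ} (hG : Integrable G) : Continuous (𝓕⁻ G) :=
  VectorFourier.fourierIntegral_continuous Real.continuous_fourierChar (by simp; fun_prop) hG

open SchwartzMap ContDiff in
theorem aux_ae_eq {f g : ℝ → ℂ} (hf : LocallyIntegrable f) (hg : LocallyIntegrable g)
    (h : ∀ φ : 𝓢(ℝ, ℂ), ∫ t, φ t • f t = ∫ t, φ t • g t) : f =ᵐ[volume] g := by
  apply ae_eq_of_integral_contDiff_smul_eq hf hg
  intro ψ hψ hc
  have hg₁ : HasCompactSupport (Complex.ofRealCLM ∘ ψ) := hc.comp_left rfl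
  have hg₂ : ContDiff ℝ ∞ (Complex.ofRealCLM ∘ ψ) := by fun_prop
  simpa using h (hg₁.toSchwartzMap hg₂)

open FourierTransform in
theorem aux_inversion {f : ℝ → ℂ} (hf : Integrable f) (hF : Integrable (𝓕 f)) :
    f =ᵐ[volume] 𝓕⁻ (𝓕 f) := by
  apply aux_ae_eq hf.locallyIntegrable (aux_contInv hF).locallyIntegrable
  intro φ
  rw [aux_fourierInv_adj hF, aux_fourier_adj hf, FourierTransform.fourier_fourierInv_eq]

open FourierTransform in
theorem aux_plancherel {G : ℝ → ℂ} (hG : Integrable G) (hG2 : MemLp G 2) :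
    MemLp (𝓕⁻ G) 2 ∧ ∫ w, ‖G w‖ ^ 2 = ∫ t, ‖(𝓕⁻ G) t‖ ^ 2 := by
  set H : Lp ℂ 2 (volume : Measure ℝ) := 𝓕⁻ (hG2.toLp G) with hH
  have hnorm : ‖H‖ = ‖hG2.toLp G‖ := (Lp.fourierTransformₗᵢ ℝ ℂ).symm.norm_map _
  have hae : H =ᵐ[volume] 𝓕⁻ G := by
    apply aux_ae_eq ((Lp.memLp H).locallyIntegrable (by norm_num))
      (aux_contInv hG).locallyIntegrable
    intro φ
    rw [aux_fourierInv_adj hG]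
    have := congrArg (fun T => T φ) (Lp.fourierInv_toTemperedDistribution_eq (hG2.toLp G))
    simp only [TemperedDistribution.fourierInv_apply, Lp.toTemperedDistribution_apply] at this
    rw [← hH] at this
    rw [← this]
    apply integral_congr_ae
    filter_upwards [hG2.coeFn_toLp] with x hx
    rw [hx]
  have hm : MemLp (𝓕⁻ G) 2 := (memLp_congr_ae hae).1 (Lp.memLp H)
  refine ⟨hm, ?_⟩
  have key : ∀ (K : Lp ℂ 2 (volume : Measure ℝ)), ‖K‖ ^ 2 = ∫ t, ‖K t‖ ^ 2 := by
    intro K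
    have h2 := @inner_self_eq_norm_sq_to_K ℂ _ _ _ _ K
    rw [L2.inner_def] at h2
    simp only [inner_self_eq_norm_sq_to_K] at h2
    have h3 : ((∫ t, ‖K t‖ ^ 2 : ℝ) : ℂ) = ((‖K‖ ^ 2 : ℝ) : ℂ) := by
      rw [← integral_complex_ofReal]; push_cast; exact h2
    exact (Complex.ofReal_injective h3).symm
  have k1 := key H
  have k2 := key (hG2.toLp G)
  rw [hnorm, k2] at k1
  rw [integral_congr_ae (g := fun t => ‖(hG2.toLp G) t‖ ^ 2), k1]
  · apply integral_congr_ae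
    filter_upwards [hae] with x hx
    rw [hx]
  · filter_upwards [hG2.coeFn_toLp] with x hx
    rw [hx]

/-- Dyadic frequency index: `0, 1, 2, 4, …`. -/
def NN : ℕ → ℝ
  | 0 => 0
  | (n + 1) => (2:ℝ) ^ n

/-- `max(N, 1)` for the dyadic index. -/
def WW : ℕ → ℝ
  | 0 => 1
  | (n + 1) => (2:ℝ) ^ n

theorem WW_pos (n : ℕ) : 0 < WW n := by
  cases n <;> simp [WW]

theorem mm_cont {χ : ℝ → ℝ} (hχ : CutoffFun χ) (n : ℕ) : Continuous (lpSymb χ (NN n)) := by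
  have := hχ.smooth.continuous
  unfold lpSymb
  split_ifs <;> fun_prop

theorem mm_bound {χ : ℝ → ℝ} (hχ : CutoffFun χ) (n : ℕ) (x : ℝ) : |lpSymb χ (NN n) x| ≤ 1 := by
  unfold lpSymb
  split_ifs
  · rw [abs_le]; constructor <;> linarith [hχ.nonneg (2*x), hχ.le_one (2*x)]
  · rw [abs_le]; constructor <;> linarith [hχ.nonneg (2*x/NN n), hχ.le_one (2*x/NN n),
      hχ.nonneg (x/NN n), hχ.le_one (x/NN n)]

theorem mm_supp {χ : ℝ → ℝ} (hχ : CutoffFun χ) (n : ℕ) (x : ℝ) (h : lpSymb χ (NN n) x ≠ 0) :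
    |x| ≤ 2 * WW n := by
  cases n with
  | zero =>
    simp only [lpSymb, NN, if_true] at h
    have := hχ.compact_supp _ h
    rw [abs_le]
    simp only [WW]
    constructor <;> linarith [this.1, this.2]
  | succ n =>
    have hp : (0:ℝ) < 2 ^ n := by positivity
    simp only [lpSymb, NN, hp.ne', if_false] at h
    by_contra! hc
    simp only [WW] at hc
    apply h
    have key : ∀ y : ℝ, 2 < |y| → χ y = 0 := by
      intro y hy
      by_contra hne
      have := hχ.compact_supp _ hne
      exact absurd (abs_le.2 this) (not_le.2 hy)
    rw [key, key, sub_zero]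
    · rw [abs_div, abs_of_pos hp, lt_div_iff₀ hp, abs_mul, abs_two]
      linarith [abs_nonneg x]
    · rw [abs_div, abs_of_pos hp, lt_div_iff₀ hp]; exact hc

theorem mm_hasSum {χ : ℝ → ℝ} (hχ : CutoffFun χ) (x : ℝ) :
    HasSum (fun n => lpSymb χ (NN n) x) 1 := by
  have hpart : ∀ J : ℕ, ∑ n ∈ Finset.range (J + 1), lpSymb χ (NN n) x = χ (2 * x / 2 ^ J) := by
    intro J
    induction J with
    | zero => simp [lpSymb, NN]
    | succ J ih =>
      rw [Finset.sum_range_succ, ih]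
      have hp : (0:ℝ) < 2 ^ J := by positivity
      simp only [lpSymb, NN, hp.ne', if_false]
      rw [show 2 * x / 2 ^ (J + 1) = x / 2 ^ J by rw [pow_succ]; field_simp]
      ring
  obtain ⟨J, hJ⟩ := pow_unbounded_of_one_lt (|2 * x|) (one_lt_two (α := ℝ))
  have hone : ∀ k, J ≤ k → χ (2 * x / 2 ^ k) = 1 ∧ χ (x / 2 ^ k) = 1 := by
    intro k hk
    have hp : (0:ℝ) < 2 ^ k := by positivity
    have h1 : (2:ℝ) ^ J ≤ 2 ^ k := pow_le_pow_right₀ (by norm_num) hk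
    rw [abs_mul, abs_two] at hJ
    constructor <;> apply hχ.eq_one <;> rw [Set.mem_Icc, ← abs_le, abs_div,
      abs_of_pos hp, div_le_one hp]
    · rw [abs_mul, abs_two]; linarith
    · linarith [abs_nonneg x]
  have : HasSum (fun n => lpSymb χ (NN n) x)
      (∑ n ∈ Finset.range (J + 1), lpSymb χ (NN n) x) := hasSum_sum_of_ne_finset_zero (f := fun n => lpSymb χ (NN n) x)
    (s := Finset.range (J + 1)) (by
      intro b hb
      simp only [Finset.mem_range, not_lt] at hb
      obtain ⟨k, rfl⟩ : ∃ k, b = k + 1 := ⟨b - 1, by omega⟩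
      have hp : (0:ℝ) < 2 ^ k := by positivity
      simp only [lpSymb, NN, hp.ne', if_false]
      rw [(hone k (by omega)).1, (hone k (by omega)).2, sub_self])
  rw [hpart, (hone J le_rfl).1] at this
  exact this

open FourierTransform in
theorem FT_eq (f : ℝ → ℂ) (w : ℝ) : FT f (2 * π * w) = 𝓕 f w := by
  rw [Real.fourier_real_eq_integral_exp_smul, FT]
  congr 1
  ext t
  rw [smul_eq_mul]
  congr 2
  push_cast
  ring

open FourierTransform in
theorem IFT_eq (g : ℝ → ℂ) (t : ℝ) : IFT g t = 𝓕⁻ (fun w => g (2 * π * w)) t := by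
  rw [Real.fourierInv_eq', IFT]
  have := Measure.integral_comp_mul_left
    (fun τ : ℝ => Complex.exp (Complex.I * τ * t) * g τ) (2 * π)
  rw [abs_of_pos (by positivity)] at this
  rw [← this]
  congr 1
  ext w
  rw [smul_eq_mul]
  congr 2
  simp only [RCLike.inner_apply, conj_trivial]
  push_cast
  ring

/-- Frequency-localized Fourier transform. -/
def GG (χ : ℝ → ℝ) (a : ℝ) (f : ℝ → ℂ) (n : ℕ) (w : ℝ) : ℂ :=
  (lpSymb χ (NN n) (2 * π * w - a) : ℂ) * (FourierTransform.fourier f : ℝ → ℂ) w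

open FourierTransform in
theorem QL_eq (χ p : ℝ → ℝ) (U : ℝ → ℤ → ℂ) (n : ℕ) (t : ℝ) (ξ : ℤ) :
    QL χ p (NN n) U t ξ = 𝓕⁻ (GG χ (p ξ) (fun s => U s ξ) n) t := by
  rw [QL, IFT_eq]
  have h : (fun w : ℝ => (lpSymb χ (NN n) (2 * π * w - p ξ) : ℂ) *
      FT (fun s => U s ξ) (2 * π * w)) = GG χ (p ξ) (fun s => U s ξ) n :=
    funext fun w => by rw [FT_eq, GG]
  rw [h]

theorem GG_cont {χ : ℝ → ℝ} (hχ : CutoffFun χ) (a : ℝ) {f : ℝ → ℂ} (hf : Integrable f) (n : ℕ) :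
    Continuous (GG χ a f n) := by
  have h1 := aux_cont hf
  have h2 := mm_cont hχ n
  unfold GG
  fun_prop

theorem GG_zero {χ : ℝ → ℝ} (hχ : CutoffFun χ) (a : ℝ) (f : ℝ → ℂ) (n : ℕ) (w : ℝ)
    (hw : w ∉ Set.Icc ((a - 2 * WW n) / (2 * π)) ((a + 2 * WW n) / (2 * π))) :
    GG χ a f n w = 0 := by
  unfold GG
  by_contra hne
  have h1 : lpSymb χ (NN n) (2 * π * w - a) ≠ 0 := by
    intro h; apply hne; simp [h]
  have := abs_le.1 (mm_supp hχ n _ h1)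
  apply hw
  have hp := Real.pi_pos
  constructor
  · rw [div_le_iff₀ (by positivity)]; linarith
  · rw [le_div_iff₀ (by positivity)]; linarith

theorem GG_compact {χ : ℝ → ℝ} (hχ : CutoffFun χ) (a : ℝ) (f : ℝ → ℂ) (n : ℕ) :
    HasCompactSupport (GG χ a f n) :=
  HasCompactSupport.intro isCompact_Icc (fun w hw => GG_zero hχ a f n w hw)

theorem GG_int {χ : ℝ → ℝ} (hχ : CutoffFun χ) (a : ℝ) {f : ℝ → ℂ} (hf : Integrable f) (n : ℕ) :
    Integrable (GG χ a f n) :=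
  (GG_cont hχ a hf n).integrable_of_hasCompactSupport (GG_compact hχ a f n)

theorem GG_L2 {χ : ℝ → ℝ} (hχ : CutoffFun χ) (a : ℝ) {f : ℝ → ℂ} (hf : Integrable f) (n : ℕ) :
    MemLp (GG χ a f n) 2 :=
  (GG_cont hχ a hf n).memLp_of_hasCompactSupport (GG_compact hχ a f n)

open FourierTransform in
theorem GG_L1 {χ : ℝ → ℝ} (hχ : CutoffFun χ) (a : ℝ) {f : ℝ → ℂ} (hf : Integrable f) (n : ℕ) :
    ∫ w, ‖GG χ a f n w‖ ≤ √(WW n) * √(∫ t, ‖(𝓕⁻ (GG χ a f n)) t‖ ^ 2) := by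
  rw [← (aux_plancherel (GG_int hχ a hf n) (GG_L2 hχ a hf n)).2]
  set S := Set.Icc ((a - 2 * WW n) / (2 * π)) ((a + 2 * WW n) / (2 * π)) with hS
  have hind : MemLp (S.indicator (fun _ => (1:ℝ))) 2 :=
    memLp_indicator_const 2 measurableSet_Icc 1 (Or.inr (by simp [hS]))
  have hcs := integral_mul_le_Lp_mul_Lq_of_nonneg (μ := volume) (p := 2) (q := 2)
    Real.HolderConjugate.two_two (f := S.indicator (fun _ => (1:ℝ))) (g := fun w => ‖GG χ a f n w‖)
    (Eventually.of_forall fun w => Set.indicator_nonneg (fun _ _ => zero_le_one) w)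
    (Eventually.of_forall fun w => norm_nonneg _)
    (by simpa using hind) (by simpa using (GG_L2 hχ a hf n).norm)
  have e1 : ∀ w, S.indicator (fun _ => (1:ℝ)) w * ‖GG χ a f n w‖ = ‖GG χ a f n w‖ := by
    intro w
    by_cases hw : w ∈ S
    · simp [hw]
    · rw [GG_zero hχ a f n w hw]; simp
  have e2 : ∀ w, S.indicator (fun _ => (1:ℝ)) w ^ (2:ℝ) = S.indicator (fun _ => (1:ℝ)) w := by
    intro w
    by_cases hw : w ∈ S <;> simp [hw]
  simp only [e1, e2] at hcs
  have hW := WW_pos n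
  have e3 : ∫ w, S.indicator (fun _ => (1:ℝ)) w ≤ WW n := by
    rw [integral_indicator measurableSet_Icc]
    simp only [integral_const, smul_eq_mul, mul_one, hS, MeasurableSet.univ, measureReal_restrict_apply, Set.univ_inter, Real.volume_real_Icc]
    apply max_le _ hW.le
    rw [← sub_div, div_le_iff₀ (by positivity)]
    nlinarith [Real.pi_gt_three]
  refine hcs.trans ?_
  rw [Real.sqrt_eq_rpow, Real.sqrt_eq_rpow]
  simp only [Real.rpow_two]
  refine mul_le_mul_of_nonneg_right ?_ (by positivity)
  exact Real.rpow_le_rpow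
    (integral_nonneg fun w => Set.indicator_nonneg (fun _ _ => zero_le_one) w) e3 (by norm_num)

open FourierTransform in
theorem GG_sup {χ : ℝ → ℝ} (hχ : CutoffFun χ) (a : ℝ) {f : ℝ → ℂ} (hf : Integrable f) (n : ℕ)
    (t : ℝ) :
    ‖(𝓕⁻ (GG χ a f n)) t‖ ≤ √(WW n) * √(∫ t, ‖(𝓕⁻ (GG χ a f n)) t‖ ^ 2) :=
  (VectorFourier.norm_fourierIntegral_le_integral_norm _ _ _ _ _).trans (GG_L1 hχ a hf n)

open FourierTransform in
theorem recon {χ : ℝ → ℝ} (hχ : CutoffFun χ) (a : ℝ) {f : ℝ → ℂ} (hf : Integrable f)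
    (hs : Summable fun n => √(WW n) * √(∫ t, ‖(𝓕⁻ (GG χ a f n)) t‖ ^ 2)) :
    ∀ᵐ t, HasSum (fun n => (𝓕⁻ (GG χ a f n)) t) (f t) := by
  have hsum : Summable fun n => ∫ w, ‖GG χ a f n w‖ :=
    Summable.of_nonneg_of_le (fun n => integral_nonneg fun w => norm_nonneg _)
      (fun n => GG_L1 hχ a hf n) hs
  have hpt : ∀ w, HasSum (fun n => GG χ a f n w) (𝓕 f w) := by
    intro w
    have h := Complex.hasSum_ofReal.2 (mm_hasSum hχ (2 * π * w - a))
    simpa [GG] using h.mul_right (𝓕 f w)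
  have hFint : Integrable (𝓕 f) := by
    refine ⟨(aux_cont hf).aestronglyMeasurable, ?_⟩
    rw [hasFiniteIntegral_iff_enorm]
    calc ∫⁻ w, ‖𝓕 f w‖ₑ ≤ ∫⁻ w, ∑' n, ‖GG χ a f n w‖ₑ := by
          apply lintegral_mono
          intro w
          beta_reduce
          rw [← (hpt w).tsum_eq]
          exact enorm_tsum_le_tsum_enorm
      _ = ∑' n, ∫⁻ w, ‖GG χ a f n w‖ₑ :=
          lintegral_tsum fun n => (GG_cont hχ a hf n).aestronglyMeasurable.enorm
      _ = ∑' n, ENNReal.ofReal (∫ w, ‖GG χ a f n w‖) := by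
          congr 1; ext n
          rw [ofReal_integral_norm_eq_lintegral_enorm (GG_int hχ a hf n)]
      _ < ⊤ := by
          rw [← ENNReal.ofReal_tsum_of_nonneg
            (fun n => integral_nonneg fun w => norm_nonneg _) hsum]
          exact ENNReal.ofReal_lt_top
  filter_upwards [aux_inversion hf hFint] with t ht
  rw [ht]
  simp only [Real.fourierInv_eq]
  have := hasSum_integral_of_summable_integral_norm (μ := volume)
    (F := fun n w => Real.fourierChar (inner ℝ w t) • GG χ a f n w)
    (fun n => by
      have := (Real.fourierIntegral_convergent_iff (μ := volume) (f := GG χ a f n) (-t)).2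
        (GG_int hχ a hf n)
      simpa using this)
    (by simpa [Circle.norm_smul] using hsum)
  have e : ∀ w : ℝ, ∑' n, Real.fourierChar (inner ℝ w t) • GG χ a f n w =
      Real.fourierChar (inner ℝ w t) • 𝓕 f w := fun w => ((hpt w).const_smul _).tsum_eq
  simp only [e] at this
  exact this

theorem L2_eq_sqrt (U : ℝ → ℤ → ℂ) : L2full U = √(∫ t : ℝ, l2sq (U t)) := by
  rw [L2full, Real.sqrt_eq_rpow]

open FourierTransform in
/-- Bounds at the level of finitely many modes. -/
theorem modes_bound {χ p : ℝ → ℝ} (hχ : CutoffFun χ) {U : ℝ → ℤ → ℂ}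
    (hUint : ∀ ξ : ℤ, Integrable fun t : ℝ => U t ξ) (n : ℕ)
    (hsm : ∀ t : ℝ, Summable fun ξ : ℤ => ‖QL χ p (NN n) U t ξ‖ ^ 2)
    (hi : Integrable fun t : ℝ => l2sq (QL χ p (NN n) U t)) (s : Finset ℤ) :
    ∑ ξ ∈ s, ∫ t, ‖QL χ p (NN n) U t ξ‖ ^ 2 ≤ ∫ t, l2sq (QL χ p (NN n) U t) := by
  rw [← integral_finsetSum]
  · apply integral_mono_of_nonneg
    · exact Eventually.of_forall fun t => Finset.sum_nonneg fun ξ _ => by positivity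
    · exact hi
    · exact Eventually.of_forall fun t => (hsm t).sum_le_tsum s (fun ξ _ => by positivity)
  · intro ξ _
    simp only [QL_eq]
    exact (aux_plancherel (GG_int hχ _ (hUint ξ) n) (GG_L2 hχ _ (hUint ξ) n)).1.integrable_norm_pow
      (by norm_num)

theorem point_bound {χ p : ℝ → ℝ} (hχ : CutoffFun χ) {U : ℝ → ℤ → ℂ}
    (hUint : ∀ ξ : ℤ, Integrable fun t : ℝ => U t ξ)
    (hsm : ∀ n, ∀ t : ℝ, Summable fun ξ : ℤ => ‖QL χ p (NN n) U t ξ‖ ^ 2)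
    (hi : ∀ n, Integrable fun t : ℝ => l2sq (QL χ p (NN n) U t)) {X : ℝ}
    (hX : HasSum (fun n => √(WW n) * L2full (QL χ p (NN n) U)) X) :
    ∀ᵐ t, ∀ s : Finset ℤ, ∑ ξ ∈ s, ‖U t ξ‖ ^ 2 ≤ X ^ 2 := by
  have hX0 : 0 ≤ X := hX.nonneg fun n => by rw [L2_eq_sqrt]; positivity
  have hsq : ∀ n t ξ, ‖QL χ p (NN n) U t ξ‖ ≤
      √(WW n) * √(∫ t, ‖QL χ p (NN n) U t ξ‖ ^ 2) := by
    intro n t ξ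
    simp only [QL_eq]
    exact GG_sup hχ _ (hUint ξ) n t
  have hrec : ∀ᵐ t, ∀ ξ : ℤ, HasSum (fun n => QL χ p (NN n) U t ξ) (U t ξ) := by
    rw [ae_all_iff]
    intro ξ
    have := recon hχ (p ξ) (hUint ξ) (by
      refine Summable.of_nonneg_of_le (fun n => by positivity) (fun n => ?_) hX.summable
      have h := modes_bound hχ hUint n (hsm n) (hi n) {ξ}
      simp only [Finset.sum_singleton] at h
      simp only [QL_eq] at h
      rw [L2_eq_sqrt]
      gcongr)
    simpa only [QL_eq] using this
  filter_upwards [hrec] with t ht s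
  let v : ℕ → EuclideanSpace ℂ s := fun n => WithLp.toLp 2 fun ξ => QL χ p (NN n) U t ξ
  let u : EuclideanSpace ℂ s := WithLp.toLp 2 fun ξ => U t ξ
  have hv : HasSum v u := by
    have h0 : HasSum (fun n => fun ξ : s => QL χ p (NN n) U t ξ) (fun ξ : s => U t ξ) :=
      Pi.hasSum.2 fun ξ => ht ξ
    exact h0.mapL ((PiLp.continuousLinearEquiv 2 ℂ (fun _ : s => ℂ)).symm :
      (s → ℂ) →L[ℂ] EuclideanSpace ℂ s)
  have hvn : ∀ n, ‖v n‖ ≤ √(WW n) * L2full (QL χ p (NN n) U) := by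
    intro n
    rw [EuclideanSpace.norm_eq, L2_eq_sqrt, ← Real.sqrt_mul (WW_pos n).le]
    apply Real.sqrt_le_sqrt
    calc ∑ ξ : s, ‖QL χ p (NN n) U t ξ‖ ^ 2
        ≤ ∑ ξ : s, WW n * ∫ t, ‖QL χ p (NN n) U t ξ‖ ^ 2 := by
          apply Finset.sum_le_sum
          intro ξ _
          have h := hsq n t ξ
          have h2 := pow_le_pow_left₀ (norm_nonneg _) h 2
          rwa [mul_pow, Real.sq_sqrt (WW_pos n).le,
            Real.sq_sqrt (integral_nonneg fun t => by positivity)] at h2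
      _ = WW n * ∑ ξ ∈ s, ∫ t, ‖QL χ p (NN n) U t ξ‖ ^ 2 := by
          rw [← Finset.mul_sum]
          congr 1
          exact Finset.sum_coe_sort s (fun ξ => ∫ t, ‖QL χ p (NN n) U t ξ‖ ^ 2)
      _ ≤ _ := mul_le_mul_of_nonneg_left (modes_bound hχ hUint n (hsm n) (hi n) s) (WW_pos n).le
  have hu : ‖u‖ ≤ X := by
    rw [← hv.tsum_eq]
    exact tsum_of_norm_bounded hX hvn
  have h3 := pow_le_pow_left₀ (norm_nonneg _) hu 2
  rw [EuclideanSpace.norm_sq_eq] at h3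
  rw [← Finset.sum_coe_sort s (fun ξ => ‖U t ξ‖ ^ 2)]
  exact h3

theorem main_bound {χ p : ℝ → ℝ} (hχ : CutoffFun χ) {U : ℝ → ℤ → ℂ} (hU : MemX χ p U) (l : ℕ) :
    L2full (fun t ξ => (χ (((2:ℝ) ^ l) * t) : ℂ) * U t ξ) ≤
          2 * ((2:ℝ) ^ l) ^ (-(1:ℝ)/2) * Xhalf χ p U := by
  obtain ⟨-, hUint, hs0, hs, hi0, hi, hsum⟩ := hU
  have hsm : ∀ n, ∀ t : ℝ, Summable fun ξ : ℤ => ‖QL χ p (NN n) U t ξ‖ ^ 2 := by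
    rintro (_ | n) t
    · exact hs0 t
    · exact hs n t
  have hin : ∀ n, Integrable fun t : ℝ => l2sq (QL χ p (NN n) U t) := by
    rintro (_ | n)
    · exact hi0
    · exact hi n
  have hX : HasSum (fun n => √(WW n) * L2full (QL χ p (NN n) U)) (Xhalf χ p U) := by
    have h1 := hsum.hasSum
    have h3 : HasSum (fun n => √(WW (n + 1)) * L2full (QL χ p (NN (n + 1)) U))
        (∑' l : ℕ, ((2:ℝ) ^ l) ^ ((1:ℝ)/2) * L2full (QL χ p ((2:ℝ) ^ l) U)) := by
      convert h1 using 3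
      · rw [Real.sqrt_eq_rpow, WW]
      · rfl
    have h2 := (hasSum_nat_add_iff (f := fun n => √(WW n) * L2full (QL χ p (NN n) U)) 1).1
      h3
    have e : Xhalf χ p U = (∑' l : ℕ, ((2:ℝ) ^ l) ^ ((1:ℝ)/2) *
        L2full (QL χ p ((2:ℝ) ^ l) U)) +
        ∑ i ∈ Finset.range 1, √(WW i) * L2full (QL χ p (NN i) U) := by
      rw [Xhalf, Finset.sum_range_one, WW, NN, Real.sqrt_one, one_mul, add_comm]
    rw [e]
    exact h2
  have hX0 : 0 ≤ Xhalf χ p U := hX.nonneg fun n => by rw [L2_eq_sqrt]; positivity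
  have hL : (0:ℝ) < 2 ^ l := by positivity
  set L : ℝ := 2 ^ l
  set X := Xhalf χ p U
  have hpt := point_bound hχ hUint hsm hin hX
  have hle : ∫ t : ℝ, l2sq (fun ξ => (χ (L * t) : ℂ) * U t ξ) ≤ 4 / L * X ^ 2 := by
    calc _ ≤ ∫ t, (Set.Icc (-2 / L) (2 / L)).indicator (fun _ => X ^ 2) t := by
          apply integral_mono_of_nonneg
          · exact Eventually.of_forall fun t => tsum_nonneg fun ξ => by positivity
          · exact (integrableOn_const (by simp)).integrable_indicator measurableSet_Icc
          · filter_upwards [hpt] with t ht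
            by_cases hm : t ∈ Set.Icc (-2 / L) (2 / L)
            · rw [Set.indicator_of_mem hm]
              refine Real.tsum_le_of_sum_le (fun ξ => by positivity) fun s => ?_
              refine (Finset.sum_le_sum fun ξ _ => ?_).trans (ht s)
              rw [norm_mul, Complex.norm_real, Real.norm_eq_abs, abs_of_nonneg (hχ.nonneg _)]
              refine pow_le_pow_left₀ (mul_nonneg (hχ.nonneg _) (norm_nonneg _)) ?_ 2
              exact mul_le_of_le_one_left (norm_nonneg _) (hχ.le_one _)
            · rw [Set.indicator_of_notMem hm]
              have : χ (L * t) = 0 := by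
                by_contra hne
                have := hχ.compact_supp _ hne
                apply hm
                constructor
                · rw [div_le_iff₀ hL]; linarith [this.1]
                · rw [le_div_iff₀ hL]; linarith [this.2]
              simp [l2sq, this]
      _ = 4 / L * X ^ 2 := by
          rw [integral_indicator measurableSet_Icc]
          simp only [integral_const, smul_eq_mul, MeasurableSet.univ, measureReal_restrict_apply,
            Set.univ_inter, Real.volume_real_Icc]
          rw [max_eq_left (by rw [← sub_div]; apply div_nonneg <;> linarith)]
          ring
  rw [L2_eq_sqrt]
  apply Real.sqrt_le_iff.2
  refine ⟨by positivity, hle.trans (le_of_eq ?_)⟩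
  rw [mul_pow, mul_pow, ← Real.rpow_natCast (L ^ _), ← Real.rpow_mul hL.le]
  rw [show -(1:ℝ) / 2 * ((2:ℕ):ℝ) = -1 by norm_num, Real.rpow_neg_one]
  ring

/-- Lemma `lem_short1`, estimate (short1):
`‖χ(Lt)u‖_{L²(ℝ×𝕋)} ≤ C L^{-1/2} ‖u‖_{X^{0,1/2,1}}` for dyadic `L ≥ 1`. -/
theorem short_time_L2_estimate
    (α ξ₀ c₀ C₀ : ℝ) (hα : α ∈ Set.Icc (1:ℝ) 2)
    (p : ℝ → ℝ) (hp : Hyp1 α ξ₀ c₀ C₀ p)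
    (χ : ℝ → ℝ) (hχ : CutoffFun χ) :
    ∃ C : ℝ, 0 < C ∧
      ∀ (U : ℝ → ℤ → ℂ), MemX χ p U →
      ∀ l : ℕ,
        L2full (fun t ξ => (χ (((2:ℝ) ^ l) * t) : ℂ) * U t ξ) ≤
          C * ((2:ℝ) ^ l) ^ (-(1:ℝ)/2) * Xhalf χ p U := by
  exact ⟨2, two_pos, fun U hU l => main_bound hχ hU l⟩

end
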